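/- There exists a universal constant C > 0 with the following property. For every d ≥ 1, every finite nonempty Ω₊ as below, every B̃ > 0, every loss ℓ : ℝ×ℝ → [0,c] that is L-Lipschitz in its second argument, every ε, δ ∈ (0,1), and every probability measure P on [0,2π)^d × ℝ: if m ≥ C·ε^{−2}·( L²·min{ max{K², B̃²·|Ω|}·log(2d), B̃²·|Ω|·log(|Ω|) } + c²·log(1/δ) ), then the m-fold product measure P^m gives probability at least 1 − δ to the set of samples S of size m such that R(f) − R̂_S(f) ≤ ε holds for every f ∈ H_Ω^{B̃}. -/

import Mathlib

open Real MeasureTheory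
open scoped ENNReal NNReal BigOperators

noncomputable section

/-- The domain `[0, 2π)^d`. -/
def box (d : ℕ) : Set (Fin d → ℝ) := Set.univ.pi fun _ => Set.Ico 0 (2 * π)

/-- Euclidean dot product `ω · x`. -/
def dot {d : ℕ} (ω x : Fin d → ℝ) : ℝ := ∑ j, ω j * x j

/-- The sign `±1` associated with a Boolean. -/
def signOf (b : Bool) : ℝ := if b then 1 else -1

/-- Empirical Rademacher complexity of a class `F` of real-valued functions with
respect to the sample points `x₁, …, x_m`:
`2^{-m} Σ_{σ ∈ {−1,1}^m} sup_{f ∈ F} (1/m) Σ_i σ_i f(x_i)`. -/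
def empRad {X : Type*} {m : ℕ} (F : Set (X → ℝ)) (x : Fin m → X) : ℝ :=
  (1 / 2 ^ m) * ∑ σ : Fin m → Bool,
    sSup ((fun f => (1 / (m : ℝ)) * ∑ i, signOf (σ i) * f (x i)) '' F)

/-- The Euclidean 2-norm of the coefficient vector `(a₀, (a_ω)_{ω∈Ω₊}, (b_ω)_{ω∈Ω₊})`. -/
def coeffNorm2 {d : ℕ} (Ωp : Finset (Fin d → ℝ)) (a0 : ℝ) (a b : (Fin d → ℝ) → ℝ) : ℝ :=
  Real.sqrt (a0 ^ 2 + ∑ ω ∈ Ωp, (a ω ^ 2 + b ω ^ 2))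

/-- The generalized trigonometric polynomial with frequencies in `Ω₊` and
coefficients `a₀, (a_ω), (b_ω)`:
`x ↦ a₀/2 + Σ_{ω∈Ω₊} (a_ω cos(ω·x) + b_ω sin(ω·x))`. -/
def gtp {d : ℕ} (Ωp : Finset (Fin d → ℝ)) (a0 : ℝ) (a b : (Fin d → ℝ) → ℝ) :
    (Fin d → ℝ) → ℝ :=
  fun x => a0 / 2 + ∑ ω ∈ Ωp, (a ω * Real.cos (dot ω x) + b ω * Real.sin (dot ω x))

/-- The class `H_Ω^{B̃}` of generalized trigonometric polynomials with frequencies in `Ω₊`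
whose coefficient vector has Euclidean 2-norm at most `B̃`. -/
def Hclass {d : ℕ} (Ωp : Finset (Fin d → ℝ)) (Bt : ℝ) : Set ((Fin d → ℝ) → ℝ) :=
  { f | ∃ a0 a b, coeffNorm2 Ωp a0 a b ≤ Bt ∧ f = gtp Ωp a0 a b }

/-- `K = Σ_{i=1}^d max_{ω∈Ω₊} |ω_i|`. -/
def Kconst {d : ℕ} (Ωp : Finset (Fin d → ℝ)) (hne : Ωp.Nonempty) : ℝ :=
  ∑ i, Ωp.sup' hne fun ω => |ω i|

end

noncomputable section

/-- The (true) risk `R(f) = ∫ ℓ(y, f(x)) dP(x,y)`. -/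
def risk {d : ℕ} (P : Measure ((Fin d → ℝ) × ℝ)) (ℓ : ℝ → ℝ → ℝ)
    (f : (Fin d → ℝ) → ℝ) : ℝ :=
  ∫ p, ℓ p.2 (f p.1) ∂P

/-- The empirical risk `R̂_S(f) = (1/m) Σ_i ℓ(y_i, f(x_i))` on the sample `S`. -/
def empRisk {d m : ℕ} (ℓ : ℝ → ℝ → ℝ) (S : Fin m → (Fin d → ℝ) × ℝ)
    (f : (Fin d → ℝ) → ℝ) : ℝ :=
  (1 / (m : ℝ)) * ∑ i, ℓ (S i).2 (f (S i).1)

end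

/-- The maximum of a finite nonempty family of reals. -/
def finMax {ι : Type*} [Fintype ι] [Nonempty ι] (u : ι → ℝ) : ℝ :=
  Finset.univ.sup' Finset.univ_nonempty u

section FinMax

variable {ι : Type*} [Fintype ι] [Nonempty ι]

lemma le_finMax (u : ι → ℝ) (i : ι) : u i ≤ finMax u :=
  Finset.le_sup' u (Finset.mem_univ i)

lemma exists_finMax_eq (u : ι → ℝ) : ∃ i, finMax u = u i := by
  obtain ⟨i, -, hi⟩ := Finset.exists_mem_eq_sup' Finset.univ_nonempty u
  exact ⟨i, hi⟩

lemma finMax_le {u : ι → ℝ} {r : ℝ} (h : ∀ i, u i ≤ r) : finMax u ≤ r :=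
  Finset.sup'_le _ _ fun i _ => h i

lemma abs_finMax_le {u : ι → ℝ} {r : ℝ} (h : ∀ i, |u i| ≤ r) : |finMax u| ≤ r := by
  obtain ⟨i, hi⟩ := exists_finMax_eq u
  exact hi ▸ h i

lemma abs_finMax_sub_finMax_le {u v : ι → ℝ} {r : ℝ} (h : ∀ i, |u i - v i| ≤ r) :
    |finMax u - finMax v| ≤ r := by
  obtain ⟨i, hi⟩ := exists_finMax_eq u
  obtain ⟨j, hj⟩ := exists_finMax_eq v
  have h1 := le_finMax v i
  have h2 := le_finMax u j
  have h3 := abs_le.1 (h i)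
  have h4 := abs_le.1 (h j)
  rw [abs_le]
  constructor <;> linarith

lemma measurable_finMax {X : Type*} [MeasurableSpace X] {f : ι → X → ℝ}
    (hf : ∀ i, Measurable (f i)) : Measurable fun x => finMax fun i => f i x := by
  have h := Finset.measurable_sup' (Finset.univ_nonempty (α := ι)) fun i _ => hf i
  convert h using 2 with x
  simp [finMax, Finset.sup'_apply]

/-- Contraction for a single pair of opposite signs. -/
lemma finMax_add_finMax_sub_le {L : ℝ} (u g a : ι → ℝ)
    (h : ∀ i j, |g i - g j| ≤ L * |a i - a j|) :
    finMax (fun i => u i + 2 * g i) + finMax (fun i => u i - 2 * g i) ≤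
      finMax (fun i => u i + 2 * L * a i) + finMax (fun i => u i - 2 * L * a i) := by
  obtain ⟨i, hi⟩ := exists_finMax_eq fun i => u i + 2 * g i
  obtain ⟨j, hj⟩ := exists_finMax_eq fun i => u i - 2 * g i
  have hij := (abs_le.1 (h i j)).2
  rw [hi, hj]
  rcases abs_cases (a i - a j) with ⟨ha, -⟩ | ⟨ha, -⟩
  · have h1 := le_finMax (fun i => u i + 2 * L * a i) i
    have h2 := le_finMax (fun i => u i - 2 * L * a i) j
    rw [ha] at hij
    linarith
  · have h1 := le_finMax (fun i => u i + 2 * L * a i) j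
    have h2 := le_finMax (fun i => u i - 2 * L * a i) i
    rw [ha] at hij
    linarith

end FinMax

lemma integrable_of_abs_le {X : Type*} [MeasurableSpace X] {μ : Measure X} [IsFiniteMeasure μ]
    {f : X → ℝ} {r : ℝ} (hf : Measurable f) (h : ∀ x, |f x| ≤ r) : Integrable f μ :=
  Integrable.of_bound hf.aestronglyMeasurable r (Filter.Eventually.of_forall h)

lemma abs_integral_le_of_abs_le {X : Type*} [MeasurableSpace X] {μ : Measure X}
    [IsProbabilityMeasure μ] {f : X → ℝ} {r : ℝ} (h : ∀ x, |f x| ≤ r) : |∫ x, f x ∂μ| ≤ r := by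
  simpa using norm_integral_le_of_norm_le_const (μ := μ) (f := f) (C := r)
    (Filter.Eventually.of_forall h)

section Product

variable {Z : Type*} [MeasurableSpace Z]

lemma measurable_fin_cons (m : ℕ) :
    Measurable fun p : Z × (Fin m → Z) => (Fin.cons p.1 p.2 : Fin (m + 1) → Z) := by
  refine measurable_pi_iff.2 fun i => ?_
  refine Fin.cases ?_ (fun j => ?_) i
  · simpa using measurable_fst
  · simp only [Fin.cons_succ]
    fun_prop

/-- Splitting off the first coordinate of an integral over a finite power. -/
lemma integral_pi_succ (P : Measure Z) [IsProbabilityMeasure P] {m : ℕ}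
    {f : (Fin (m + 1) → Z) → ℝ} {r : ℝ} (hf : Measurable f) (hr : ∀ S, |f S| ≤ r) :
    ∫ S, f S ∂(Measure.pi fun _ => P) =
      ∫ z, ∫ S, f (Fin.cons z S) ∂(Measure.pi fun _ : Fin m => P) ∂P := by
  rw [← ((measurePreserving_piFinSuccAbove (fun _ : Fin (m + 1) => P) 0).symm).integral_comp',
    integral_prod]
  · simp [MeasurableEquiv.piFinSuccAbove, Fin.insertNthEquiv]
  · refine integrable_of_abs_le (r := r) ?_ fun _ => hr _
    exact hf.comp (MeasurableEquiv.measurable _)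

/-- Hoeffding's lemma for a function of bounded oscillation. -/
lemma integral_exp_le_of_oscillation (P : Measure Z) [IsProbabilityMeasure P] {Y : Z → ℝ}
    {c : ℝ} (hY : Measurable Y) (hosc : ∀ z z', |Y z - Y z'| ≤ c) (t : ℝ) :
    ∫ z, exp (t * Y z) ∂P ≤ exp (t * ∫ z, Y z ∂P + t ^ 2 * c ^ 2 / 8) := by
  obtain ⟨z₀⟩ : Nonempty Z := nonempty_of_isProbabilityMeasure P
  have hbdd : BddBelow (Set.range Y) :=
    ⟨Y z₀ - c, by rintro _ ⟨z, rfl⟩; linarith [(abs_le.1 (hosc z z₀)).1]⟩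
  have : Nonempty Z := ⟨z₀⟩
  have hmem : ∀ z, Y z ∈ Set.Icc (⨅ z, Y z) ((⨅ z, Y z) + c) := fun z => by
    refine ⟨ciInf_le hbdd z, ?_⟩
    have : Y z - c ≤ ⨅ z, Y z := le_ciInf fun z' => by linarith [(abs_le.1 (hosc z z')).2]
    linarith
  have h := (ProbabilityTheory.hasSubgaussianMGF_of_mem_Icc (μ := P) hY.aemeasurable
    (Filter.Eventually.of_forall hmem)).mgf_le t
  rw [ProbabilityTheory.mgf] at h
  have hsplit : ∀ z, exp (t * Y z) = exp (t * ∫ z, Y z ∂P) * exp (t * (Y z - ∫ z, Y z ∂P)) :=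
    fun z => by rw [← exp_add]; ring_nf
  simp_rw [hsplit]
  rw [integral_const_mul, exp_add]
  refine mul_le_mul_of_nonneg_left (h.trans (le_of_eq ?_)) (exp_pos _).le
  congr 1
  simp only [add_sub_cancel_left, NNReal.coe_pow, NNReal.coe_div, coe_nnnorm, norm_eq_abs,
    NNReal.coe_ofNat, div_pow, sq_abs]
  ring

/-- The exponential-moment form of McDiarmid's bounded differences inequality. -/
lemma integral_exp_le_of_bounded_differences (P : Measure Z) [IsProbabilityMeasure P] {c : ℝ}
    (t : ℝ) (m : ℕ) (X : (Fin m → Z) → ℝ) {r : ℝ} (hX : Measurable X) (hr : ∀ S, |X S| ≤ r)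
    (hdiff : ∀ S k z, |X (Function.update S k z) - X S| ≤ c) :
    ∫ S, exp (t * X S) ∂(Measure.pi fun _ => P) ≤
      exp (t * ∫ S, X S ∂(Measure.pi fun _ => P) + m * (t ^ 2 * c ^ 2 / 8)) := by
  induction m generalizing r with
  | zero =>
    have : ∀ S, X S = X default := fun S => by rw [Subsingleton.elim S default]
    simp_rw [this]
    simp
  | succ m ih =>
    have hcons := measurable_fin_cons (Z := Z) m
    have hXc : Measurable fun p : Z × (Fin m → Z) => X (Fin.cons p.1 p.2) := hX.comp hcons
    have hexp : ∀ S, |exp (t * X S)| ≤ exp (|t| * r) := fun S => by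
      rw [abs_of_pos (exp_pos _), exp_le_exp]
      refine (le_abs_self _).trans ?_
      rw [abs_mul]
      exact mul_le_mul_of_nonneg_left (hr S) (abs_nonneg t)
    set Y : Z → ℝ := fun z => ∫ S, X (Fin.cons z S) ∂(Measure.pi fun _ : Fin m => P) with hYdef
    have hY : Measurable Y := hXc.stronglyMeasurable.integral_prod_right.measurable
    have hYr : ∀ z, |Y z| ≤ r := fun z => abs_integral_le_of_abs_le fun _ => hr _
    have hint : ∀ z, Integrable (fun S => X (Fin.cons z S)) (Measure.pi fun _ : Fin m => P) :=
      fun z => integrable_of_abs_le (hXc.comp measurable_prodMk_left) fun _ => hr _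
    have hosc : ∀ z z', |Y z - Y z'| ≤ c := fun z z' => by
      rw [hYdef, ← integral_sub (hint z) (hint z')]
      refine abs_integral_le_of_abs_le fun S => ?_
      simpa using hdiff (Fin.cons z' S) 0 z
    have hstep : ∀ z, ∫ S, exp (t * X (Fin.cons z S)) ∂(Measure.pi fun _ : Fin m => P) ≤
        exp (m * (t ^ 2 * c ^ 2 / 8)) * exp (t * Y z) := fun z => by
      rw [← exp_add, add_comm ((m : ℝ) * _)]
      refine ih (fun S => X (Fin.cons z S)) (hXc.comp measurable_prodMk_left) (fun _ => hr _) ?_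
      intro S k z'
      simpa using hdiff (Fin.cons z S) k.succ z'
    rw [integral_pi_succ P (by fun_prop) hexp, integral_pi_succ P hX hr]
    calc _ ≤ ∫ z, exp (m * (t ^ 2 * c ^ 2 / 8)) * exp (t * Y z) ∂P := by
          refine integral_mono (integrable_of_abs_le (r := exp (|t| * r)) ?_ ?_)
            (Integrable.const_mul (integrable_of_abs_le (r := exp (|t| * r)) (by fun_prop) ?_) _)
            hstep
          · have : Measurable fun p : Z × (Fin m → Z) => exp (t * X (Fin.cons p.1 p.2)) := by
              fun_prop
            exact this.stronglyMeasurable.integral_prod_right.measurable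
          · exact fun z => abs_integral_le_of_abs_le fun _ => hexp _
          · intro z
            rw [abs_of_pos (exp_pos _), exp_le_exp]
            refine (le_abs_self _).trans ?_
            rw [abs_mul]
            exact mul_le_mul_of_nonneg_left (hYr z) (abs_nonneg t)
      _ ≤ exp (m * (t ^ 2 * c ^ 2 / 8)) * exp (t * ∫ z, Y z ∂P + t ^ 2 * c ^ 2 / 8) := by
          rw [integral_const_mul]
          exact mul_le_mul_of_nonneg_left (integral_exp_le_of_oscillation P hY hosc t)
            (exp_pos _).le
      _ = _ := by
          rw [← exp_add, hYdef]
          push_cast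
          ring_nf

end Product

section UniformDeviation

variable {Z E ι : Type*} [MeasurableSpace Z] [NormedAddCommGroup E] [InnerProductSpace ℝ E]
  [Fintype ι] [Nonempty ι]

/-- Symmetrization and contraction in one coordinate. -/
lemma integral_finMax_sub_le (P : Measure Z) [IsProbabilityMeasure P] {c L r : ℝ} (u : ι → ℝ)
    {g a : ι → Z → ℝ} (hg : ∀ i, Measurable (g i)) (hgc : ∀ i z, |g i z| ≤ c)
    (ha : ∀ i, Measurable (a i)) (har : ∀ i z, |a i z| ≤ r)
    (h : ∀ i j z, |g i z - g j z| ≤ L * |a i z - a j z|) :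
    ∫ z, finMax (fun i => u i + (∫ z', g i z' ∂P - g i z)) ∂P ≤
      ∫ z, (finMax (fun i => u i + 2 * L * a i z) +
        finMax (fun i => u i - 2 * L * a i z)) / 2 ∂P := by
  obtain ⟨U, hU⟩ : ∃ U, ∀ i, |u i| ≤ U :=
    ⟨finMax fun i => |u i|, fun i => le_finMax (fun i => |u i|) i⟩
  have hint : ∀ {b : ι → Z → ℝ} {s : ℝ}, (∀ i, Measurable (b i)) → (∀ i z, |b i z| ≤ s) →
      ∀ k : ℝ, Integrable (fun z => finMax fun i => u i + k * b i z) P := by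
    intro b s hb hbs k
    refine integrable_of_abs_le (r := U + |k| * s) (measurable_finMax fun i => by fun_prop)
      fun z => abs_finMax_le fun i => (abs_add_le _ _).trans (add_le_add (hU i) ?_)
    rw [abs_mul]
    exact mul_le_mul_of_nonneg_left (hbs i z) (abs_nonneg k)
  have hgp := hint hg hgc 2
  have hgm := hint hg hgc (-2)
  have hap := hint ha har (2 * L)
  have ham := hint ha har (-(2 * L))
  simp only [neg_mul, ← sub_eq_add_neg] at hgm ham
  set M := ∫ z, finMax (fun i => u i + 2 * g i z) ∂P with hM
  have hmean : ∀ i, u i + 2 * ∫ z, g i z ∂P ≤ M := fun i => by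
    have hgi : Integrable (fun z => 2 * g i z) P :=
      (integrable_of_abs_le (hg i) (hgc i)).const_mul 2
    calc u i + 2 * ∫ z, g i z ∂P = ∫ z, (u i + 2 * g i z) ∂P := by
          rw [integral_add (integrable_const _) hgi, integral_const_mul]
          simp
      _ ≤ M := integral_mono ((integrable_const _).add hgi) hgp
          fun z => le_finMax (fun i => u i + 2 * g i z) i
  have hpt : ∀ z, finMax (fun i => u i + (∫ z', g i z' ∂P - g i z)) ≤
      (M + finMax (fun i => u i - 2 * g i z)) / 2 := fun z => finMax_le fun i => by
    have h1 := hmean i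
    have h2 := le_finMax (fun i => u i - 2 * g i z) i
    linarith
  have hleft : Integrable (fun z => finMax fun i => u i + (∫ z', g i z' ∂P - g i z)) P := by
    refine integrable_of_abs_le (r := U + (c + c)) (measurable_finMax fun i => by fun_prop)
      fun z => abs_finMax_le fun i => (abs_add_le _ _).trans (add_le_add (hU i)
        ((abs_sub _ _).trans (add_le_add (abs_integral_le_of_abs_le (hgc i)) (hgc i z))))
  calc _ ≤ ∫ z, (M + finMax (fun i => u i - 2 * g i z)) / 2 ∂P :=
        integral_mono hleft (((integrable_const M).add hgm).div_const 2) hpt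
    _ = ∫ z, (finMax (fun i => u i + 2 * g i z) + finMax (fun i => u i - 2 * g i z)) / 2 ∂P := by
        rw [integral_div, integral_div, integral_add (integrable_const M) hgm,
          integral_add hgp hgm]
        simp [hM]
    _ ≤ _ := integral_mono ((hgp.add hgm).div_const 2) ((hap.add ham).div_const 2) fun z =>
        div_le_div_of_nonneg_right
          (finMax_add_finMax_sub_le u (fun i => g i z) (fun i => a i z) fun i j => h i j z)
          zero_le_two

/-- The largest total deviation of the `g i` on a sample `S`, tilted by a linear functional. -/
noncomputable def deviation (P : Measure Z) (g : ι → Z → ℝ) (θ : ι → E) (v : E) {m : ℕ} (S : Fin m → Z) : ℝ :=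
  finMax fun i => inner ℝ (θ i) v + ∑ k, (∫ z, g i z ∂P - g i (S k))

variable {P : Measure Z} {g : ι → Z → ℝ} {θ : ι → E} {c : ℝ}

lemma measurable_deviation_prod {α : Type*} [MeasurableSpace α] (hg : ∀ i, Measurable (g i))
    {v : α → E} (hv : ∀ i, Measurable fun x => (inner ℝ (θ i) (v x) : ℝ)) (m : ℕ) :
    Measurable fun p : α × (Fin m → Z) => deviation P g θ (v p.1) p.2 := by
  refine measurable_finMax fun i => ((hv i).comp measurable_fst).add ?_
  fun_prop

lemma measurable_deviation (hg : ∀ i, Measurable (g i)) (v : E) (m : ℕ) :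
    Measurable fun S : Fin m → Z => deviation P g θ v S := by
  refine measurable_finMax fun i => ?_
  fun_prop

lemma abs_deviation_le [IsProbabilityMeasure P] (hgc : ∀ i z, |g i z| ≤ c) {B s : ℝ} (hB : 0 ≤ B)
    (hθ : ∀ i, ‖θ i‖ ≤ B) {v : E} (hv : ‖v‖ ≤ s) {m : ℕ} (S : Fin m → Z) :
    |deviation P g θ v S| ≤ B * s + m * (c + c) := by
  refine abs_finMax_le fun i => (abs_add_le _ _).trans (add_le_add ?_ ?_)
  · exact (abs_real_inner_le_norm _ _).trans (mul_le_mul (hθ i) hv (norm_nonneg _) hB)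
  · refine (Finset.abs_sum_le_sum_abs _ _).trans ((Finset.sum_le_card_nsmul _ _ (c + c)
      fun k _ => ?_).trans_eq (by simp [mul_add]))
    exact (abs_sub _ _).trans (add_le_add (abs_integral_le_of_abs_le (hgc i)) (hgc i _))

lemma deviation_cons (v : E) {m : ℕ} (z : Z) (S : Fin m → Z) :
    deviation P g θ v (Fin.cons z S : Fin (m + 1) → Z) =
      finMax fun i => (inner ℝ (θ i) v + ∑ k, (∫ z, g i z ∂P - g i (S k))) +
        (∫ z, g i z ∂P - g i z) := by
  simp only [deviation, Fin.sum_univ_succ, Fin.cons_zero, Fin.cons_succ]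
  congr 1
  ext i
  ring

/-- The expected deviation of a contraction of a bounded linear class. -/
lemma integral_deviation_le [IsProbabilityMeasure P] {L B R α β : ℝ} (hB : 0 ≤ B)
    (hβ : 0 ≤ β) (hαβ : ∀ x, B * x ≤ α + β * x ^ 2)
    (hg : ∀ i, Measurable (g i)) (hgc : ∀ i z, |g i z| ≤ c) (hθ : ∀ i, ‖θ i‖ ≤ B) {φ : Z → E}
    (hφ : ∀ i, Measurable fun z => (inner ℝ (θ i) (φ z) : ℝ)) (hφR : ∀ z, ‖φ z‖ ≤ R)
    (h : ∀ i j z, |g i z - g j z| ≤ L * |inner ℝ (θ i) (φ z) - inner ℝ (θ j) (φ z)|)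
    (m : ℕ) (v : E) :
    ∫ S, deviation P g θ v S ∂(Measure.pi fun _ : Fin m => P) ≤
      α + β * (‖v‖ ^ 2 + m * (4 * L ^ 2 * R ^ 2)) := by
  induction m generalizing v with
  | zero =>
    have hle : ∀ S : Fin 0 → Z, deviation P g θ v S ≤ α + β * ‖v‖ ^ 2 := fun S => by
      refine finMax_le fun i => ?_
      simp only [Finset.univ_eq_empty, Finset.sum_empty, add_zero]
      exact (real_inner_le_norm _ _).trans
        ((mul_le_mul_of_nonneg_right (hθ i) (norm_nonneg v)).trans (hαβ _))
    have hdev := integrable_of_abs_le (μ := Measure.pi fun _ : Fin 0 => P)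
      (measurable_deviation hg v 0) (abs_deviation_le (P := P) hgc hB hθ le_rfl)
    simpa using integral_mono hdev (integrable_const _) hle
  | succ m ih =>
    have hshift : ∀ (k : ℝ) z, ‖v + k • φ z‖ ≤ ‖v‖ + |k| * R := fun k z => by
      refine (norm_add_le _ _).trans (add_le_add_right ?_ _)
      rw [norm_smul]
      exact mul_le_mul_of_nonneg_left (hφR z) (abs_nonneg k)
    have hmeas : ∀ k : ℝ, Measurable fun p : Z × (Fin m → Z) =>
        deviation P g θ (v + k • φ p.1) p.2 := fun k =>
      measurable_deviation_prod hg (v := fun z => v + k • φ z) (fun i => by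
        simp only [inner_add_right, inner_smul_right]
        exact ((hφ i).const_mul k).const_add _) m
    have hbd : ∀ (k : ℝ) (p : Z × (Fin m → Z)), |deviation P g θ (v + k • φ p.1) p.2| ≤
        B * (‖v‖ + |k| * R) + m * (c + c) := fun k p =>
      abs_deviation_le hgc hB hθ (hshift k p.1) p.2
    have hint : ∀ k : ℝ, Integrable (fun p : Z × (Fin m → Z) =>
        deviation P g θ (v + k • φ p.1) p.2) (P.prod (Measure.pi fun _ => P)) := fun k =>
      integrable_of_abs_le (hmeas k) (hbd k)
    have hcons : Integrable (fun p : Z × (Fin m → Z) =>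
        deviation P g θ v (Fin.cons p.1 p.2 : Fin (m + 1) → Z))
        (P.prod (Measure.pi fun _ => P)) :=
      integrable_of_abs_le ((measurable_deviation hg v (m + 1)).comp (measurable_fin_cons m))
        fun _ => abs_deviation_le hgc hB hθ le_rfl _
    have hcoord : ∀ S : Fin m → Z,
        ∫ z, deviation P g θ v (Fin.cons z S : Fin (m + 1) → Z) ∂P ≤
          ∫ z, (deviation P g θ (v + (2 * L) • φ z) S +
            deviation P g θ (v + (-(2 * L)) • φ z) S) / 2 ∂P := fun S => by
      simp only [deviation_cons]
      refine (integral_finMax_sub_le P _ hg hgc hφ (r := B * R) (fun i z => ?_) h).trans_eq ?_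
      · exact (abs_real_inner_le_norm _ _).trans
          (mul_le_mul (hθ i) (hφR z) (norm_nonneg _) hB)
      · simp only [deviation, inner_add_right, inner_smul_right]
        congr 1
        ext z
        congr 3 <;> ext i <;> ring
    have hslice : ∀ (k : ℝ) z, Integrable (fun S : Fin m → Z => deviation P g θ (v + k • φ z) S)
        (Measure.pi fun _ => P) := fun k z =>
      integrable_of_abs_le (measurable_deviation hg _ m) fun _ =>
        abs_deviation_le hgc hB hθ le_rfl _
    have hsum := ((hint (2 * L)).add (hint (-(2 * L)))).div_const 2
    rw [integral_pi_succ P (measurable_deviation hg v (m + 1))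
      (abs_deviation_le hgc hB hθ le_rfl), integral_integral_swap hcons]
    calc _ ≤ ∫ S, ∫ z, (deviation P g θ (v + (2 * L) • φ z) S +
            deviation P g θ (v + (-(2 * L)) • φ z) S) / 2 ∂P ∂(Measure.pi fun _ => P) :=
          integral_mono hcons.integral_prod_right hsum.integral_prod_right hcoord
      _ = ∫ z, ∫ S, (deviation P g θ (v + (2 * L) • φ z) S +
            deviation P g θ (v + (-(2 * L)) • φ z) S) / 2 ∂(Measure.pi fun _ => P) ∂P :=
          (integral_integral_swap hsum).symm
      _ ≤ ∫ _, α + β * (‖v‖ ^ 2 + (m + 1 : ℕ) * (4 * L ^ 2 * R ^ 2)) ∂P := by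
          refine integral_mono hsum.integral_prod_left (integrable_const _) fun z => ?_
          dsimp only
          rw [integral_div, integral_add (hslice _ z) (hslice _ z)]
          have h1 := ih (v + (2 * L) • φ z)
          have h2 := ih (v + (-(2 * L)) • φ z)
          have hpar : ‖v + (2 * L) • φ z‖ ^ 2 + ‖v + (-(2 * L)) • φ z‖ ^ 2 =
              2 * (‖v‖ ^ 2 + 4 * L ^ 2 * ‖φ z‖ ^ 2) := by
            have := parallelogram_law_with_norm ℝ v ((2 * L) • φ z)
            rw [neg_smul, ← sub_eq_add_neg, this, norm_smul, norm_eq_abs, mul_pow, sq_abs]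
            ring
          have hR : ‖φ z‖ ^ 2 ≤ R ^ 2 := pow_le_pow_left₀ (norm_nonneg _) (hφR z) 2
          have hle : β * (‖v + (2 * L) • φ z‖ ^ 2 + ‖v + (-(2 * L)) • φ z‖ ^ 2) ≤
              β * (2 * (‖v‖ ^ 2 + 4 * L ^ 2 * R ^ 2)) := by
            rw [hpar]
            gcongr
          push_cast
          linarith
      _ = _ := by simp

/-- The upper tail of the deviation of a contraction of a bounded linear class. -/
lemma measure_lt_deviation_le [IsProbabilityMeasure P] {L B R ε δ : ℝ} {m : ℕ}
    (hc : 0 < c) (hL : 0 < L) (hB : 0 < B) (hR : 0 < R) (hε : 0 < ε) (hδ : 0 < δ)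
    (hg : ∀ i, Measurable (g i)) (hgc : ∀ i z, g i z ∈ Set.Icc 0 c)
    (hθ : ∀ i, ‖θ i‖ ≤ B) {φ : Z → E}
    (hφ : ∀ i, Measurable fun z => (inner ℝ (θ i) (φ z) : ℝ)) (hφR : ∀ z, ‖φ z‖ ≤ R)
    (h : ∀ i j z, |g i z - g j z| ≤ L * |inner ℝ (θ i) (φ z) - inner ℝ (θ j) (φ z)|)
    (hm₁ : 16 * (L ^ 2 * B ^ 2 * R ^ 2) ≤ m * ε ^ 2)
    (hm₂ : 2 * c ^ 2 * Real.log (1 / δ) ≤ m * ε ^ 2) :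
    (Measure.pi fun _ : Fin m => P) {S | m * ε ≤ deviation P g θ 0 S} ≤ ENNReal.ofReal δ := by
  have hgabs : ∀ i z, |g i z| ≤ c := fun i z => by
    rw [abs_of_nonneg (hgc i z).1]
    exact (hgc i z).2
  have hdm := measurable_deviation (P := P) (θ := θ) hg 0 m
  have hdb : ∀ S : Fin m → Z, |deviation P g θ 0 S| ≤ _ :=
    abs_deviation_le (P := P) hgabs hB.le hθ le_rfl
  set μ := Measure.pi fun _ : Fin m => P with hμ
  have hmean : ∫ S, deviation P g θ 0 S ∂μ ≤ m * ε / 2 := by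
    have hden : 0 < 16 * L ^ 2 * R ^ 2 := by positivity
    have h0 := integral_deviation_le (P := P) (α := 4 * L ^ 2 * B ^ 2 * R ^ 2 / ε)
      (β := ε / (16 * L ^ 2 * R ^ 2)) hB.le (by positivity) (fun x => ?_) hg hgabs hθ hφ hφR h m 0
    · refine h0.trans ?_
      have e1 : 4 * L ^ 2 * B ^ 2 * R ^ 2 / ε ≤ m * ε / 4 := by
        rw [div_le_iff₀ hε]
        nlinarith
      have e2 : ε / (16 * L ^ 2 * R ^ 2) * (‖(0 : E)‖ ^ 2 + m * (4 * L ^ 2 * R ^ 2)) =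
          m * ε / 4 := by
        rw [norm_zero]
        field_simp
        ring
      linarith
    · have key : 4 * L ^ 2 * B ^ 2 * R ^ 2 / ε + ε / (16 * L ^ 2 * R ^ 2) * x ^ 2 - B * x =
          (8 * L ^ 2 * R ^ 2 * B - ε * x) ^ 2 / (16 * L ^ 2 * R ^ 2 * ε) := by
        field_simp
        ring
      have : 0 ≤ (8 * L ^ 2 * R ^ 2 * B - ε * x) ^ 2 / (16 * L ^ 2 * R ^ 2 * ε) := by positivity
      linarith
  have hdiff : ∀ (S : Fin m → Z) k z,
      |deviation P g θ 0 (Function.update S k z) - deviation P g θ 0 S| ≤ c := fun S k z => by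
    refine abs_finMax_sub_finMax_le fun i => ?_
    rw [add_sub_add_left_eq_sub, ← Finset.sum_sub_distrib, Finset.sum_eq_single k]
    · rw [Function.update_self, abs_le]
      have h1 := hgc i z
      have h2 := hgc i (S k)
      constructor <;> linarith [h1.1, h1.2, h2.1, h2.2]
    · intro j _ hj
      simp [Function.update_of_ne hj]
    · simp
  set t := 2 * ε / c ^ 2 with ht
  have ht0 : 0 < t := by positivity
  have hmgf := integral_exp_le_of_bounded_differences P t m _ hdm hdb hdiff
  have hexp : Integrable (fun S => exp (t * deviation P g θ 0 S)) μ := by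
    refine integrable_of_abs_le (r := exp (t * (B * ‖(0 : E)‖ + m * (c + c)))) (by fun_prop)
      fun S => ?_
    rw [abs_of_pos (exp_pos _), exp_le_exp]
    exact mul_le_mul_of_nonneg_left ((le_abs_self _).trans (hdb S)) ht0.le
  have hcher := ProbabilityTheory.measure_ge_le_exp_mul_mgf (μ := μ) (m * ε) ht0.le hexp
  rw [← ofReal_measureReal]
  refine ENNReal.ofReal_le_ofReal (hcher.trans ?_)
  calc _ ≤ exp (-t * (m * ε)) * exp (t * (m * ε / 2) + m * (t ^ 2 * c ^ 2 / 8)) := by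
        refine mul_le_mul_of_nonneg_left (hmgf.trans (exp_le_exp.2 ?_)) (exp_pos _).le
        gcongr
    _ = exp (-(m * ε ^ 2 / (2 * c ^ 2))) := by
        rw [← exp_add, ht]
        congr 1
        field_simp
        ring
    _ ≤ exp (Real.log δ) := by
        rw [exp_le_exp, neg_le, ← Real.log_inv, le_div_iff₀ (by positivity), ← one_div]
        linarith
    _ = δ := exp_log hδ

end UniformDeviation

section Trigonometric

variable {d : ℕ}

/-- The vector `(1/2, (cos (ω · x))_ω, (sin (ω · x))_ω)`. -/
noncomputable def trigFeature (Ωp : Finset (Fin d → ℝ)) (x : Fin d → ℝ) :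
    EuclideanSpace ℝ (Option (Ωp ⊕ Ωp)) :=
  WithLp.toLp 2 fun o => o.elim (1 / 2)
    (Sum.elim (fun ω => Real.cos (dot ω x)) fun ω => Real.sin (dot ω x))

/-- The coefficients of a generalized trigonometric polynomial as a Euclidean vector. -/
noncomputable def coeffVec (Ωp : Finset (Fin d → ℝ)) (a0 : ℝ) (a b : (Fin d → ℝ) → ℝ) :
    EuclideanSpace ℝ (Option (Ωp ⊕ Ωp)) :=
  WithLp.toLp 2 fun o => o.elim a0 (Sum.elim (fun ω => a ω) fun ω => b ω)

lemma inner_coeffVec_trigFeature (Ωp : Finset (Fin d → ℝ)) (a0 : ℝ) (a b : (Fin d → ℝ) → ℝ)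
    (x : Fin d → ℝ) :
    inner ℝ (coeffVec Ωp a0 a b) (trigFeature Ωp x) = gtp Ωp a0 a b x := by
  simp only [coeffVec, trigFeature, gtp, PiLp.inner_apply, Fintype.sum_option, Fintype.sum_sum_type,
    Option.elim, Sum.elim_inl, Sum.elim_inr, RCLike.inner_apply, conj_trivial,
    Finset.sum_add_distrib, Finset.sum_coe_sort Ωp fun ω => Real.cos (dot ω x) * a ω,
    Finset.sum_coe_sort Ωp fun ω => Real.sin (dot ω x) * b ω]
  simp only [mul_comm]
  ring

lemma norm_coeffVec (Ωp : Finset (Fin d → ℝ)) (a0 : ℝ) (a b : (Fin d → ℝ) → ℝ) :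
    ‖coeffVec Ωp a0 a b‖ = coeffNorm2 Ωp a0 a b := by
  simp only [coeffVec, coeffNorm2, EuclideanSpace.norm_eq, Fintype.sum_option,
    Fintype.sum_sum_type, Option.elim, Sum.elim_inl, Sum.elim_inr, norm_eq_abs, sq_abs,
    Finset.sum_add_distrib, Finset.sum_coe_sort Ωp fun ω => a ω ^ 2,
    Finset.sum_coe_sort Ωp fun ω => b ω ^ 2]

lemma norm_trigFeature_le (Ωp : Finset (Fin d → ℝ)) (x : Fin d → ℝ) :
    ‖trigFeature Ωp x‖ ≤ √(2 * Ωp.card + 1) := by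
  rw [EuclideanSpace.norm_eq]
  refine Real.sqrt_le_sqrt ?_
  simp only [trigFeature, Fintype.sum_option, Fintype.sum_sum_type, Option.elim, Sum.elim_inl,
    Sum.elim_inr, norm_eq_abs, sq_abs, ← Finset.sum_add_distrib, Real.cos_sq_add_sin_sq]
  simp
  have : (0 : ℝ) ≤ Ωp.card := Nat.cast_nonneg _
  linarith

lemma measurable_trigFeature (Ωp : Finset (Fin d → ℝ)) : Measurable (trigFeature Ωp) := by
  refine (WithLp.measurable_toLp 2 _).comp (measurable_pi_iff.2 fun o => ?_)
  have hdot : ∀ ω : Fin d → ℝ, Measurable (dot ω) := fun ω => by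
    unfold dot
    fun_prop
  rcases o with _ | ω | ω
  · exact measurable_const
  · exact Real.measurable_cos.comp (hdot ω)
  · exact Real.measurable_sin.comp (hdot ω)

end Trigonometric

section LinearClass

variable {X E : Type*} [MeasurableSpace X] [NormedAddCommGroup E] [InnerProductSpace ℝ E]
  [MeasurableSpace E] [BorelSpace E]

/-- Tail bound for the generalization gap over finitely many linear predictors. -/
lemma measure_exists_gap_le {ι : Type*} [Fintype ι] [Nonempty ι] [SecondCountableTopology E]
    {P : Measure (X × ℝ)} [IsProbabilityMeasure P] {ℓ : ℝ → ℝ → ℝ} {L B R c ε δ : ℝ} {m : ℕ}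
    (hm : 0 < m)
    (hc : 0 < c) (hL : 0 < L) (hB : 0 < B) (hR : 0 < R) (hε : 0 < ε) (hδ : 0 < δ)
    (hℓ : ∀ y z, ℓ y z ∈ Set.Icc 0 c) (hℓL : ∀ y z z', |ℓ y z - ℓ y z'| ≤ L * |z - z'|)
    {φ : X → E} (hφ : Measurable φ) (hφR : ∀ x, ‖φ x‖ ≤ R) {θ : ι → E} (hθ : ∀ i, ‖θ i‖ ≤ B)
    (hmeas : ∀ i, AEStronglyMeasurable (fun p => ℓ p.2 (inner ℝ (θ i) (φ p.1))) P)
    (hm₁ : 16 * (L ^ 2 * B ^ 2 * R ^ 2) ≤ m * ε ^ 2)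
    (hm₂ : 2 * c ^ 2 * Real.log (1 / δ) ≤ m * ε ^ 2) :
    (Measure.pi fun _ : Fin m => P) {S | ∃ i, ε < ∫ p, ℓ p.2 (inner ℝ (θ i) (φ p.1)) ∂P -
      (1 / (m : ℝ)) * ∑ k, ℓ (S k).2 (inner ℝ (θ i) (φ (S k).1))} ≤ ENNReal.ofReal δ := by
  set f : ι → X × ℝ → ℝ := fun i p => ℓ p.2 (inner ℝ (θ i) (φ p.1)) with hf
  obtain ⟨N, hN, hNm, hNP⟩ : ∃ N, {p | ∃ i, f i p ≠ (hmeas i).mk _ p} ⊆ N ∧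
      MeasurableSet N ∧ P N = 0 := by
    refine exists_measurable_superset_of_null ?_
    have h : ∀ᵐ p ∂P, ∀ i, f i p = (hmeas i).mk _ p := ae_all_iff.2 fun i => (hmeas i).ae_eq_mk
    simpa [ae_iff] using h
  have hae : ∀ i, Nᶜ.indicator (f i) =ᵐ[P] f i := fun i => by
    filter_upwards [compl_mem_ae_iff.2 hNP] with p hp using Set.indicator_of_mem hp _
  have hg : ∀ i, Measurable (Nᶜ.indicator (f i)) := fun i => by
    have : Nᶜ.indicator (f i) = Nᶜ.indicator ((hmeas i).mk _) :=
      Set.indicator_congr fun p hp => by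
        by_contra hne
        exact hp (hN ⟨i, hne⟩)
    rw [this]
    exact (hmeas i).stronglyMeasurable_mk.measurable.indicator hNm.compl
  have htail := measure_lt_deviation_le (P := P) (g := fun i => Nᶜ.indicator (f i)) (θ := θ)
    (φ := fun p => φ p.1) (L := L) (R := R) (m := m) hc hL hB hR hε hδ hg
    (fun i p => ?_) hθ (fun i => ?_) (fun p => hφR p.1) (fun i j p => ?_) hm₁ hm₂
  · refine (measure_mono_ae ?_).trans htail
    have hS : ∀ᵐ S ∂(Measure.pi fun _ : Fin m => P), ∀ k, S k ∈ Nᶜ :=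
      Filter.eventually_all.2 fun k =>
        Measure.tendsto_eval_ae_ae.eventually (compl_mem_ae_iff.2 hNP)
    filter_upwards [hS] with S hS
    rintro ⟨i, hi⟩
    have hm0 : (0 : ℝ) < m := Nat.cast_pos.2 hm
    have hdev := le_finMax (fun i => inner ℝ (θ i) (0 : E) +
      ∑ k, (∫ p, Nᶜ.indicator (f i) p ∂P - Nᶜ.indicator (f i) (S k))) i
    simp only [inner_zero_right, zero_add, integral_congr_ae (hae i),
      Set.indicator_of_mem (hS _), Finset.sum_sub_distrib, Finset.sum_const, Finset.card_univ,
      Fintype.card_fin, nsmul_eq_mul] at hdev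
    have hgap : (m : ℝ) * ε < m * (∫ p, f i p ∂P - (1 / (m : ℝ)) * ∑ k, f i (S k)) :=
      mul_lt_mul_of_pos_left hi hm0
    have e : (m : ℝ) * (∫ p, f i p ∂P - (1 / (m : ℝ)) * ∑ k, f i (S k)) =
        m * ∫ p, f i p ∂P - ∑ k, f i (S k) := by
      field_simp
    rw [e] at hgap
    refine hgap.le.trans (hdev.trans_eq ?_)
    simp [deviation, integral_congr_ae (hae _), Set.indicator_of_mem (hS _)]
  · by_cases hp : p ∈ Nᶜ
    · simpa [Set.indicator_of_mem hp] using hℓ _ _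
    · simpa [Set.indicator_of_notMem hp] using hc.le
  · exact (measurable_const.inner (hφ.comp measurable_fst))
  · by_cases hp : p ∈ Nᶜ
    · simpa only [Set.indicator_of_mem hp] using hℓL _ _ _
    · simp only [Set.indicator_of_notMem hp, sub_self, abs_zero]
      positivity

/-- Tail bound for the generalization gap over a ball of linear predictors. The loss need not be
measurable: predictors with non-measurable loss have integral zero. -/
lemma measure_exists_gap_ball_le [SecondCountableTopology E]
    {P : Measure (X × ℝ)} [IsProbabilityMeasure P] {ℓ : ℝ → ℝ → ℝ} {L B R c ε δ : ℝ} {m : ℕ}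
    (hm : 0 < m)
    (hc : 0 < c) (hL : 0 < L) (hB : 0 < B) (hR : 0 < R) (hε : 0 < ε) (hδ : 0 < δ)
    (hℓ : ∀ y z, ℓ y z ∈ Set.Icc 0 c) (hℓL : ∀ y, LipschitzWith (Real.toNNReal L) (ℓ y))
    {φ : X → E} (hφ : Measurable φ) (hφR : ∀ x, ‖φ x‖ ≤ R)
    (hm₁ : 16 * (L ^ 2 * B ^ 2 * R ^ 2) ≤ m * ε ^ 2)
    (hm₂ : 2 * c ^ 2 * Real.log (1 / δ) ≤ m * ε ^ 2) :
    (Measure.pi fun _ : Fin m => P)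
      {S | ∃ θ : E, ‖θ‖ ≤ B ∧ ε < ∫ p, ℓ p.2 (inner ℝ θ (φ p.1)) ∂P -
        (1 / (m : ℝ)) * ∑ k, ℓ (S k).2 (inner ℝ θ (φ (S k).1))} ≤ ENNReal.ofReal δ := by
  set A : Set E := {θ | ‖θ‖ ≤ B ∧
    AEStronglyMeasurable (fun p => ℓ p.2 (inner ℝ θ (φ p.1))) P} with hA
  set gap : E → (Fin m → X × ℝ) → ℝ := fun θ S => ∫ p, ℓ p.2 (inner ℝ θ (φ p.1)) ∂P -
    (1 / (m : ℝ)) * ∑ k, ℓ (S k).2 (inner ℝ θ (φ (S k).1)) with hgap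
  have hmemA : ∀ θ S, ‖θ‖ ≤ B → ε < gap θ S → θ ∈ A := fun θ S hθ hlt => by
    refine ⟨hθ, ?_⟩
    by_contra hmeas
    rw [hgap] at hlt
    dsimp only at hlt
    rw [integral_non_aestronglyMeasurable hmeas] at hlt
    have : 0 ≤ (1 / (m : ℝ)) * ∑ k, ℓ (S k).2 (inner ℝ θ (φ (S k).1)) :=
      mul_nonneg (by positivity) (Finset.sum_nonneg fun k _ => (hℓ _ _).1)
    linarith
  rcases A.eq_empty_or_nonempty with hempty | hne
  · have : {S | ∃ θ : E, ‖θ‖ ≤ B ∧ ε < gap θ S} = ∅ := by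
      refine Set.eq_empty_of_forall_notMem ?_
      rintro S ⟨θ, hθ, hlt⟩
      simpa [hempty] using hmemA θ S hθ hlt
    rw [this]
    simp
  have : Nonempty A := hne.to_subtype
  have hcont : ∀ p : X × ℝ, Continuous fun θ : A => ℓ p.2 (inner ℝ (θ : E) (φ p.1)) := fun p =>
    (hℓL p.2).continuous.comp (continuous_subtype_val.inner continuous_const)
  have hgapcont : ∀ S, Continuous fun θ : A => gap θ S := fun S => by
    refine Continuous.sub (continuous_of_dominated (bound := fun _ => c) (fun θ => θ.2.2)
      (fun θ => Filter.Eventually.of_forall fun p => ?_) (integrable_const c)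
      (Filter.Eventually.of_forall hcont))
      (continuous_const.mul (continuous_finsetSum _ fun k _ => hcont (S k)))
    rw [norm_eq_abs, abs_of_nonneg (hℓ _ _).1]
    exact (hℓ _ _).2
  set u : ℕ → A := TopologicalSpace.denseSeq A
  have hsub : {S | ∃ θ : E, ‖θ‖ ≤ B ∧ ε < gap θ S} ⊆
      ⋃ n : ℕ, {S | ∃ i : Fin (n + 1), ε < gap (u i) S} := by
    rintro S ⟨θ, hθ, hlt⟩
    have hopen : IsOpen {θ : A | ε < gap θ S} := isOpen_lt continuous_const (hgapcont S)
    obtain ⟨_, hmem, n, rfl⟩ := (TopologicalSpace.denseRange_denseSeq A).inter_open_nonempty _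
      hopen ⟨⟨θ, hmemA θ S hθ hlt⟩, hlt⟩
    exact Set.mem_iUnion.2 ⟨n, Fin.last n, by simpa using hmem⟩
  have hmono : Monotone fun n : ℕ => {S | ∃ i : Fin (n + 1), ε < gap (u i) S} := by
    rintro n n' hn S ⟨i, hi⟩
    exact ⟨Fin.castLE (by lia) i, hi⟩
  refine (measure_mono hsub).trans ?_
  rw [hmono.measure_iUnion]
  refine iSup_le fun n => ?_
  refine measure_exists_gap_le (θ := fun i : Fin (n + 1) => (u i : E)) hm hc hL hB hR hε hδ hℓ
    (fun y z z' => ?_) hφ hφR (fun i => (u i).2.1) (fun i => (u i).2.2) hm₁ hm₂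
  simpa [Real.dist_eq, hL.le] using (hℓL y).dist_le_mul z z'

end LinearClass

/-- Sample complexity bound (Version 1): there is a universal constant
`C > 0` such that a sample of size
`m ≥ C·ε⁻²·(L²·min{max{K², B̃²|Ω|}·log(2d), B̃²|Ω|·log|Ω|} + c²·log(1/δ))`
suffices to guarantee, with probability at least `1 − δ`, generalization gap at most `ε`
uniformly over `H_Ω^{B̃}`. Here `|Ω| = 2|Ω₊| + 1`. -/
theorem sample_complexity_gtp_rademacher :
    ∃ C : ℝ, 0 < C ∧
      ∀ (d : ℕ), 1 ≤ d → ∀ (Ωp : Finset (Fin d → ℝ)) (hne : Ωp.Nonempty),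
        (∀ ω ∈ Ωp, ω ≠ 0) → (∀ ω ∈ Ωp, -ω ∉ Ωp) →
        ∀ (Bt : ℝ), 0 < Bt →
        ∀ (c L : ℝ), 0 < c → 0 < L →
        ∀ (ℓ : ℝ → ℝ → ℝ), (∀ y z, ℓ y z ∈ Set.Icc 0 c) →
          (∀ y : ℝ, LipschitzWith (Real.toNNReal L) fun z => ℓ y z) →
        ∀ (ε δ : ℝ), ε ∈ Set.Ioo (0 : ℝ) 1 → δ ∈ Set.Ioo (0 : ℝ) 1 →
        ∀ (P : Measure ((Fin d → ℝ) × ℝ)), IsProbabilityMeasure P →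
          P {p | p.1 ∈ box d} = 1 →
        ∀ (m : ℕ),
          C * ε⁻¹ ^ 2 *
              (L ^ 2 *
                  min
                    (max (Kconst Ωp hne ^ 2) (Bt ^ 2 * (2 * Ωp.card + 1)) *
                      Real.log (2 * d))
                    (Bt ^ 2 * (2 * Ωp.card + 1) * Real.log (2 * Ωp.card + 1)) +
                c ^ 2 * Real.log (1 / δ)) ≤ (m : ℝ) →
          ENNReal.ofReal (1 - δ) ≤
            (Measure.pi fun _ : Fin m => P)
              {S | ∀ f ∈ Hclass Ωp Bt, risk P ℓ f - empRisk ℓ S f ≤ ε} := by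
  refine ⟨32, by norm_num, ?_⟩
  intro d hd Ωp hne _ _ Bt hBt c L hc hL ℓ hℓ hℓL ε δ hε hδ P hP _ m hm
  have hε0 : 0 < ε := hε.1
  have hlog : 0 < Real.log (1 / δ) := Real.log_pos (one_lt_one_div hδ.1 hδ.2)
  have hlog2 : (1 : ℝ) / 2 ≤ Real.log 2 := by linarith [Real.log_two_gt_d9]
  have hd1 : (1 : ℝ) ≤ d := Nat.one_le_cast.2 hd
  have hcard : (1 : ℝ) ≤ Ωp.card := Nat.one_le_cast.2 hne.card_pos
  have hV : 0 ≤ Bt ^ 2 * (2 * Ωp.card + 1 : ℝ) := by positivity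
  set M := min (max (Kconst Ωp hne ^ 2) (Bt ^ 2 * (2 * Ωp.card + 1)) * Real.log (2 * d))
    (Bt ^ 2 * (2 * Ωp.card + 1) * Real.log (2 * Ωp.card + 1)) with hMdef
  have hM : Bt ^ 2 * (2 * Ωp.card + 1) * (1 / 2) ≤ M := by
    refine le_min ?_ ?_
    · refine mul_le_mul (le_max_right _ _) (hlog2.trans ?_) (by norm_num)
        (hV.trans (le_max_right _ _))
      exact Real.log_le_log two_pos (by linarith)
    · exact mul_le_mul_of_nonneg_left
        (hlog2.trans (Real.log_le_log two_pos (by linarith))) hV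
  have hmε : 32 * (L ^ 2 * M + c ^ 2 * Real.log (1 / δ)) ≤ m * ε ^ 2 := by
    have h := mul_le_mul_of_nonneg_right hm (sq_nonneg ε)
    refine le_trans (le_of_eq ?_) h
    field_simp
  have hLM := mul_le_mul_of_nonneg_left hM (sq_nonneg L)
  have hLV : 0 ≤ L ^ 2 * (Bt ^ 2 * (2 * Ωp.card + 1 : ℝ)) := by positivity
  have hcl : 0 < c ^ 2 * Real.log (1 / δ) := by positivity
  have hm0 : 0 < m := by
    rcases Nat.eq_zero_or_pos m with rfl | h
    · rw [Nat.cast_zero, zero_mul] at hmε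
      linarith
    · exact h
  have hR : √(2 * Ωp.card + 1 : ℝ) ^ 2 = 2 * Ωp.card + 1 := Real.sq_sqrt (by positivity)
  have hbad := measure_exists_gap_ball_le (P := P) (m := m) hm0 hc hL hBt
    (Real.sqrt_pos.2 (by positivity : (0 : ℝ) < 2 * Ωp.card + 1)) hε0 hδ.1 hℓ hℓL
    (measurable_trigFeature Ωp) (norm_trigFeature_le Ωp) (by rw [hR]; linarith) (by linarith)
  set good : Set (Fin m → (Fin d → ℝ) × ℝ) :=
    {S | ∀ f ∈ Hclass Ωp Bt, risk P ℓ f - empRisk ℓ S f ≤ ε}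
  have hcompl : goodᶜ ⊆ _ := fun S (hS : ¬ ∀ f ∈ Hclass Ωp Bt, _) => by
    push Not at hS
    obtain ⟨_, ⟨a0, a, b, hn, rfl⟩, hlt⟩ := hS
    refine (⟨coeffVec Ωp a0 a b, (norm_coeffVec Ωp a0 a b).trans_le hn, ?_⟩ :
      S ∈ {S | ∃ θ : EuclideanSpace ℝ (Option (Ωp ⊕ Ωp)), ‖θ‖ ≤ Bt ∧
        ε < ∫ p, ℓ p.2 (inner ℝ θ (trigFeature Ωp p.1)) ∂P -
          (1 / (m : ℝ)) * ∑ k, ℓ (S k).2 (inner ℝ θ (trigFeature Ωp (S k).1))})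
    simp only [inner_coeffVec_trigFeature]
    exact hlt
  rw [ENNReal.ofReal_sub _ hδ.1.le, ENNReal.ofReal_one, tsub_le_iff_right]
  calc (1 : ℝ≥0∞) = (Measure.pi fun _ : Fin m => P) (good ∪ goodᶜ) := by
        rw [Set.union_compl_self, measure_univ]
    _ ≤ _ := (measure_union_le _ _).trans (add_le_add_right ((measure_mono hcompl).trans hbad) _)
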